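/- arXiv:2401.10856 — 2 statements merged into one kernel-verified Lean document; each statement's English description precedes it below -/
import Mathlib

section
/- Let e = {u₁,u₂} be an edge. If X and Y are both minimal mincuts of e (that is, each is a mincut containing both u₁ and u₂ but not r, of minimum cardinality among all mincuts containing u₁ and u₂ but not r), then X = Y. In other words, if a minimal mincut of an edge exists, it is unique. -/
open Finset

variable {V : Type*} [Fintype V] [DecidableEq V]

/-- `cutW w X Y` is `C(X,Y) = Σ_{x∈X} Σ_{y∈Y} w(x,y)`. -/
def cutW (w : V → V → ℝ) (X Y : Finset V) : ℝ := ∑ x ∈ X, ∑ y ∈ Y, w x y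

/-- `C(X) := C(X, V ∖ X)`. -/
def cutVal (w : V → V → ℝ) (X : Finset V) : ℝ := cutW w X Xᶜ

/-- A cut is a nonempty proper subset of `V`. -/
def IsCut (X : Finset V) : Prop := X.Nonempty ∧ X ≠ Finset.univ

/-- A mincut is a cut of minimum weight. -/
def IsMincut (w : V → V → ℝ) (X : Finset V) : Prop :=
  IsCut X ∧ ∀ Y : Finset V, IsCut Y → cutVal w X ≤ cutVal w Y

/-- `X` and `Y` cross if `X∩Y`, `X∖Y`, `Y∖X` and `V∖(X∪Y)` are all nonempty. -/
def Crosses (X Y : Finset V) : Prop :=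
  (X ∩ Y).Nonempty ∧ (X \ Y).Nonempty ∧ (Y \ X).Nonempty ∧ ((X ∪ Y)ᶜ).Nonempty

/-- A minimal mincut of a vertex `v`: a mincut containing `v` but not the root `r`,
of minimum cardinality among all such mincuts. -/
def IsMinimalMincutOfVertex (w : V → V → ℝ) (r v : V) (X : Finset V) : Prop :=
  IsMincut w X ∧ v ∈ X ∧ r ∉ X ∧
    ∀ Y : Finset V, IsMincut w Y → v ∈ Y → r ∉ Y → X.card ≤ Y.card

/-- An edge is an unordered pair of distinct vertices with positive weight. -/
def IsEdge (w : V → V → ℝ) (u₁ u₂ : V) : Prop := u₁ ≠ u₂ ∧ 0 < w u₁ u₂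

/-- A minimal mincut of an edge `{u₁,u₂}`: a mincut containing both endpoints but not the
root `r`, of minimum cardinality among all such mincuts. -/
def IsMinimalMincutOfEdge (w : V → V → ℝ) (r u₁ u₂ : V) (X : Finset V) : Prop :=
  IsEdge w u₁ u₂ ∧ IsMincut w X ∧ u₁ ∈ X ∧ u₂ ∈ X ∧ r ∉ X ∧
    ∀ Y : Finset V, IsMincut w Y → u₁ ∈ Y → u₂ ∈ Y → r ∉ Y → X.card ≤ Y.card

theorem cutVal_eq_ind (w : V → V → ℝ) (X : Finset V) :
    cutVal w X = ∑ x, ∑ y, if x ∈ X ∧ y ∉ X then w x y else 0 := by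
  unfold cutVal cutW
  rw [← Finset.sum_filter_add_sum_filter_not Finset.univ (fun x => x ∈ X)]
  have h2 : ∑ x ∈ Finset.univ.filter (fun x => ¬ x ∈ X),
      (∑ y, if x ∈ X ∧ y ∉ X then w x y else 0) = 0 := by
    apply Finset.sum_eq_zero
    intro x hx
    apply Finset.sum_eq_zero
    intro y _
    simp at hx
    simp [hx]
  rw [h2, add_zero]
  have h3 : Finset.univ.filter (fun x => x ∈ X) = X := by ext; simp
  rw [h3]
  apply Finset.sum_congr rfl
  intro x hx
  have h4 : Xᶜ = Finset.univ.filter (fun y => y ∉ X) := by ext; simp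
  rw [h4, Finset.sum_filter]
  simp [hx]

theorem cutVal_submod (w : V → V → ℝ) (hn : ∀ x y, 0 ≤ w x y) (X Y : Finset V) :
    cutVal w (X ∩ Y) + cutVal w (X ∪ Y) ≤ cutVal w X + cutVal w Y := by
  simp only [cutVal_eq_ind, ← Finset.sum_add_distrib]
  apply Finset.sum_le_sum
  intro x _
  apply Finset.sum_le_sum
  intro y _
  have := hn x y
  by_cases h1 : x ∈ X <;> by_cases h2 : x ∈ Y <;> by_cases h3 : y ∈ X <;>
    by_cases h4 : y ∈ Y <;> simp [h1, h2, h3, h4] <;> linarith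

/-- the minimal mincut of an edge, if it exists, is unique. -/
theorem minimal_mincut_of_edge_unique
    (r : V) (w : V → V → ℝ)
    (hcard : 1 < Fintype.card V)
    (hsym : ∀ x y, w x y = w y x)
    (hnonneg : ∀ x y, 0 ≤ w x y)
    (hdiag : ∀ x, w x x = 0)
    (u₁ u₂ : V) (he : IsEdge w u₁ u₂)
    (X Y : Finset V)
    (hX : IsMinimalMincutOfEdge w r u₁ u₂ X)
    (hY : IsMinimalMincutOfEdge w r u₁ u₂ Y) :
    X = Y := by
  obtain ⟨-, hXm, hX1, hX2, hXr, hXmin⟩ := hX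
  obtain ⟨-, hYm, hY1, hY2, hYr, hYmin⟩ := hY
  have hIc : IsCut (X ∩ Y) := by
    refine ⟨⟨u₁, by simp [hX1, hY1]⟩, fun h => ?_⟩
    have : r ∈ X ∩ Y := h ▸ Finset.mem_univ r
    simp [hXr] at this
  have hUc : IsCut (X ∪ Y) := by
    refine ⟨⟨u₁, by simp [hX1]⟩, fun h => ?_⟩
    have : r ∈ X ∪ Y := h ▸ Finset.mem_univ r
    simp [hXr, hYr] at this
  have hs := cutVal_submod w hnonneg X Y
  have hI : IsMincut w (X ∩ Y) := by
    refine ⟨hIc, fun Z hZ => ?_⟩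
    have a := hYm.2 _ hUc
    have b := hXm.2 Z hZ
    linarith
  have m1 : u₁ ∈ X ∩ Y := by simp [hX1, hY1]
  have m2 : u₂ ∈ X ∩ Y := by simp [hX2, hY2]
  have m3 : r ∉ X ∩ Y := by simp [hXr]
  have e1 := Finset.eq_of_subset_of_card_le Finset.inter_subset_left (hXmin _ hI m1 m2 m3)
  have e2 := Finset.eq_of_subset_of_card_le Finset.inter_subset_right (hYmin _ hI m1 m2 m3)
  exact e1.symm.trans e2
end

section
/- Let (C₀,…,C_ℓ) be a chain and let X := C₀ ∪ ⋯ ∪ C_ℓ. Then every edge leaving X has its endpoint in X lying in C₀ or in C_ℓ; that is, for every edge {x,y} with x ∈ X and y ∉ X, we have x ∈ C₀ ∪ C_ℓ. -/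
open Finset

variable {V : Type*} [Fintype V] [DecidableEq V]

/-- Union of the members of a chain. -/
def chainUnion (C : List (Finset V)) : Finset V := C.foldr (· ∪ ·) ∅

/-- `X ⊆ V∖{r}` has a certificate if it is the minimal mincut of some vertex,
the minimal mincut of some edge, or the union of a chain, where a chain is a sequence
`(C₀,…,C_ℓ)` (`ℓ ≥ 1`) of pairwise disjoint nonempty subsets of `V∖{r}` such that every
`C_i` has a certificate and each `C_i ∪ C_{i+1}` is the minimal mincut of some edge. -/
inductive HasCert (w : V → V → ℝ) (r : V) : Finset V → Prop
  | vertex {v : V} {X : Finset V} : IsMinimalMincutOfVertex w r v X → HasCert w r X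
  | edge {u₁ u₂ : V} {X : Finset V} : IsMinimalMincutOfEdge w r u₁ u₂ X → HasCert w r X
  | chain {C : List (Finset V)} :
      2 ≤ C.length →
      (∀ A ∈ C, A.Nonempty) →
      (∀ A ∈ C, r ∉ A) →
      C.Pairwise (fun A B => Disjoint A B) →
      (∀ A ∈ C, HasCert w r A) →
      (∀ i (h : i + 1 < C.length),
        ∃ u₁ u₂, IsMinimalMincutOfEdge w r u₁ u₂
          (C.get ⟨i, Nat.lt_of_succ_lt h⟩ ∪ C.get ⟨i + 1, h⟩)) →
      HasCert w r (chainUnion C)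

/-- `(C₀,…,C_ℓ)` with `ℓ ≥ 1` is a chain. -/
def IsMincutChain (w : V → V → ℝ) (r : V) (C : List (Finset V)) : Prop :=
  2 ≤ C.length ∧
  (∀ A ∈ C, A.Nonempty) ∧
  (∀ A ∈ C, r ∉ A) ∧
  C.Pairwise (fun A B => Disjoint A B) ∧
  (∀ A ∈ C, HasCert w r A) ∧
  (∀ i (h : i + 1 < C.length),
    ∃ u₁ u₂, IsMinimalMincutOfEdge w r u₁ u₂
      (C.get ⟨i, Nat.lt_of_succ_lt h⟩ ∪ C.get ⟨i + 1, h⟩))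

/-- A subchain is a consecutive subsequence of a chain or of its reversal. -/
def IsSubchain (D C : List (Finset V)) : Prop := D <:+: C ∨ D <:+: C.reverse

/-- A maximal chain is a chain that is not a subchain of any strictly longer chain. -/
def IsMaximalMincutChain (w : V → V → ℝ) (r : V) (C : List (Finset V)) : Prop :=
  IsMincutChain w r C ∧
    ¬ ∃ D : List (Finset V), IsMincutChain w r D ∧ C.length < D.length ∧ IsSubchain C D

/-- `lam` is the minimum weight of a cut. -/
def IsMincutValue (w : V → V → ℝ) (lam : ℝ) : Prop :=
  (∃ X : Finset V, IsCut X ∧ cutVal w X = lam) ∧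
  ∀ X : Finset V, IsCut X → lam ≤ cutVal w X

theorem cutW_union_left_aux (w : V → V → ℝ) {A B : Finset V} (Y : Finset V) (h : Disjoint A B) :
    cutW w (A ∪ B) Y = cutW w A Y + cutW w B Y := by
  unfold cutW; exact Finset.sum_union h

theorem cutW_comm_aux (w : V → V → ℝ) (hsym : ∀ x y, w x y = w y x) (A B : Finset V) :
    cutW w A B = cutW w B A := by
  unfold cutW; rw [Finset.sum_comm]; simp only [hsym]

theorem cutW_union_right_aux (w : V → V → ℝ) (X : Finset V) {A B : Finset V} (h : Disjoint A B) :
    cutW w X (A ∪ B) = cutW w X A + cutW w X B := by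
  unfold cutW
  rw [← Finset.sum_add_distrib]
  exact Finset.sum_congr rfl fun x _ => Finset.sum_union h

/-- In three consecutive chain members no edge leaves the union from the middle one. -/
theorem middle_aux (r : V) (w : V → V → ℝ)
    (hsym : ∀ x y, w x y = w y x) (hnonneg : ∀ x y, 0 ≤ w x y)
    (P Q R : Finset V) (hPQ : Disjoint P Q) (hPR : Disjoint P R) (hQR : Disjoint Q R)
    (hP : P.Nonempty) (hR : R.Nonempty) (hrP : r ∉ P) (hrR : r ∉ R)
    (h1 : IsMincut w (P ∪ Q)) (h2 : IsMincut w (Q ∪ R))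
    (x y : V) (hx : x ∈ Q) (hyP : y ∉ P) (hyQ : y ∉ Q) (hyR : y ∉ R) : w x y = 0 := by
  obtain ⟨S, hS⟩ : ∃ S, S = (P ∪ Q ∪ R)ᶜ := ⟨_, rfl⟩
  have hyS : y ∈ S := by simp [hS, hyP, hyQ, hyR]
  rw [Finset.disjoint_left] at hPQ hPR hQR
  have dPS : Disjoint P S := by
    rw [Finset.disjoint_left]; intro a ha; simp [hS, ha]
  have dQS : Disjoint Q S := by
    rw [Finset.disjoint_left]; intro a ha; simp [hS, ha]
  have dRS : Disjoint R S := by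
    rw [Finset.disjoint_left]; intro a ha; simp [hS, ha]
  have e1 : (P ∪ Q)ᶜ = R ∪ S := by
    ext a; have t1 := @hPQ a; have t2 := @hPR a; have t3 := @hQR a
    simp only [hS, mem_compl, mem_union]; clear * - t1 t2 t3; grind
  have e2 : (Q ∪ R)ᶜ = P ∪ S := by
    ext a; have t1 := @hPQ a; have t2 := @hPR a; have t3 := @hQR a
    simp only [hS, mem_compl, mem_union]; clear * - t1 t2 t3; grind
  have e3 : Pᶜ = Q ∪ (R ∪ S) := by
    ext a; have t1 := @hPQ a; have t2 := @hPR a; have t3 := @hQR a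
    simp only [hS, mem_compl, mem_union]; clear * - t1 t2 t3; grind
  have e4 : Rᶜ = P ∪ (Q ∪ S) := by
    ext a; have t1 := @hPQ a; have t2 := @hPR a; have t3 := @hQR a
    simp only [hS, mem_compl, mem_union]; clear * - t1 t2 t3; grind
  rw [← Finset.disjoint_left] at hPQ hPR hQR
  have c1 := h1.2 P ⟨hP, fun h => hrP (h ▸ mem_univ r)⟩
  have c2 := h2.2 R ⟨hR, fun h => hrR (h ▸ mem_univ r)⟩
  unfold cutVal at c1 c2
  rw [e1, e3, cutW_union_left_aux w _ hPQ, cutW_union_right_aux w _ dRS,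
    cutW_union_right_aux w _ dRS,
    cutW_union_right_aux w _ (disjoint_union_right.2 ⟨hQR, dQS⟩),
    cutW_union_right_aux w _ dRS] at c1
  rw [e2, e4, cutW_union_left_aux w _ hQR, cutW_union_right_aux w _ dPS,
    cutW_union_right_aux w _ dPS,
    cutW_union_right_aux w _ (disjoint_union_right.2 ⟨hPQ, dPS⟩),
    cutW_union_right_aux w _ dQS] at c2
  have s1 := cutW_comm_aux w hsym P Q
  have s2 := cutW_comm_aux w hsym Q R
  have hle : cutW w Q S ≤ 0 := by linarith
  have g1 : w x y ≤ ∑ b ∈ S, w x b :=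
    Finset.single_le_sum (f := fun b => w x b) (fun b _ => hnonneg x b) hyS
  have g2 : ∑ b ∈ S, w x b ≤ cutW w Q S :=
    Finset.single_le_sum (f := fun a => ∑ b ∈ S, w a b)
      (fun a _ => Finset.sum_nonneg fun b _ => hnonneg a b) hx
  linarith [hnonneg x y]

theorem mem_chainUnion_aux (C : List (Finset V)) (x : V) :
    x ∈ chainUnion C ↔ ∃ A ∈ C, x ∈ A := by
  induction C with
  | nil => simp [chainUnion]
  | cons A C ih =>
    have : chainUnion (A :: C) = A ∪ chainUnion C := rfl
    simp [this, ih]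

/-- any edge leaving the union `X` of a chain `(C₀,…,C_ℓ)` has its endpoint
inside `X` lying in `C₀` or in `C_ℓ`. -/
theorem chain_edges_leave_at_ends
    (r : V) (w : V → V → ℝ)
    (hcard : 1 < Fintype.card V)
    (hsym : ∀ x y, w x y = w y x)
    (hnonneg : ∀ x y, 0 ≤ w x y)
    (hdiag : ∀ x, w x x = 0)
    (C : List (Finset V)) (hC : IsMincutChain w r C) (hne : C ≠ [])
    (x y : V) (hxy : x ≠ y) (hw : 0 < w x y)
    (hx : x ∈ chainUnion C) (hy : y ∉ chainUnion C) :
    x ∈ C.head hne ∪ C.getLast hne := by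
  obtain ⟨-, hnon, hr, hdis, -, hmin⟩ := hC
  rw [mem_chainUnion_aux] at hx hy
  push Not at hy
  obtain ⟨A, hA, hxA⟩ := hx
  obtain ⟨i, hi, rfl⟩ := List.getElem_of_mem hA
  rw [mem_union]
  by_cases h0 : i = 0
  · left
    subst h0
    rwa [List.head_eq_getElem]
  by_cases hl : i + 1 = C.length
  · right
    rw [List.getLast_eq_getElem]
    have : C.length - 1 = i := by omega
    simpa only [this] using hxA
  exfalso
  obtain ⟨j, rfl⟩ : ∃ j, i = j + 1 := ⟨i - 1, by omega⟩
  have hj2 : j + 1 + 1 < C.length := by omega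
  obtain ⟨_, _, m1⟩ := hmin j hi
  obtain ⟨_, _, m2⟩ := hmin (j + 1) hj2
  rw [List.pairwise_iff_getElem] at hdis
  have hj : j < C.length := by omega
  have mj := List.getElem_mem hj
  have mj2 := List.getElem_mem hj2
  have := middle_aux r w hsym hnonneg C[j] C[j+1] C[j+1+1]
    (hdis _ _ _ _ (by omega)) (hdis _ _ _ _ (by omega)) (hdis _ _ _ _ (by omega))
    (hnon _ mj) (hnon _ mj2) (hr _ mj) (hr _ mj2) m1.2.1 m2.2.1 x y hxA
    (hy _ mj) (hy _ hA) (hy _ mj2)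
  exact hw.ne' this
end
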